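/- arXiv:1906.08644 — 4 statements merged into one kernel-verified Lean document; each statement's English description precedes it below -/
import Mathlib

section
/- For every fixed t in I, all eigenvalues of the birth and death matrix A(t) are real, pairwise distinct (simple), and strictly positive. -/
open Matrix Polynomial

/-- The `(n+1) × (n+1)` birth and death matrix with off-diagonal data `a`, `b`:
diagonal `a j + b j`, superdiagonal `a j`, subdiagonal `b j`. -/
noncomputable def bdMatrix (n : ℕ) (a b : ℕ → ℝ) : Matrix (Fin (n+1)) (Fin (n+1)) ℝ :=
  Matrix.of fun i j =>
    if (i : ℕ) = (j : ℕ) then a i.1 + b i.1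
    else if (j : ℕ) = (i : ℕ) + 1 then a i.1
    else if (i : ℕ) = (j : ℕ) + 1 then b i.1
    else 0

/-- Extension of a vector by zero. -/
noncomputable def bdExt (n : ℕ) (x : Fin (n+1) → ℝ) : ℕ → ℝ :=
  fun k => if h : k < n + 1 then x ⟨k, h⟩ else 0

lemma bd_row_sum (n : ℕ) (a b : ℕ → ℝ) (x : Fin (n+1) → ℝ) (i : ℕ) (hi : i < n + 1) :
    (bdMatrix n a b *ᵥ x) ⟨i, hi⟩ = ∑ k ∈ Finset.range (n+1),
      ((if i = k then (a i + b i) * bdExt n x k else 0)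
        + (if i + 1 = k then a i * bdExt n x k else 0)
        + (if i = k + 1 then b i * bdExt n x k else 0)) := by
  rw [← Fin.sum_univ_eq_sum_range (fun k => ((if i = k then (a i + b i) * bdExt n x k else 0)
        + (if i + 1 = k then a i * bdExt n x k else 0)
        + (if i = k + 1 then b i * bdExt n x k else 0)))]
  simp only [Matrix.mulVec, dotProduct, bdMatrix, Matrix.of_apply]
  refine Finset.sum_congr rfl fun j _ => ?_
  have hx : bdExt n x j = x j := dif_pos j.2
  rw [hx]
  by_cases h1 : i = (j : ℕ)
  · have h2 : ¬ (i + 1 = (j : ℕ)) := by omega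
    have h3 : ¬ (i = (j : ℕ) + 1) := by omega
    rw [if_pos h1, if_pos h1, if_neg h2, if_neg h3]; ring
  · by_cases h2 : i + 1 = (j : ℕ)
    · have h3 : ¬ (i = (j : ℕ) + 1) := by omega
      rw [if_neg h1, if_neg h1, if_pos h2.symm, if_pos h2, if_neg h3]; ring
    · by_cases h3 : i = (j : ℕ) + 1
      · rw [if_neg h1, if_neg h1, if_neg (fun h => h2 h.symm), if_neg h2, if_pos h3, if_pos h3]; ring
      · rw [if_neg h1, if_neg h1, if_neg (fun h => h2 h.symm), if_neg h2, if_neg h3, if_neg h3]; ring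

lemma bdExt_of_not_lt (n : ℕ) (x : Fin (n+1) → ℝ) (k : ℕ) (h : ¬ k < n + 1) : bdExt n x k = 0 := by
  simp [bdExt, h]

lemma bd_row_zero (n : ℕ) (a b : ℕ → ℝ) (x : Fin (n+1) → ℝ) (l : ℝ)
    (h : bdMatrix n a b *ᵥ x = l • x) :
    (a 0 + b 0) * bdExt n x 0 + a 0 * bdExt n x 1 = l * bdExt n x 0 := by
  have h0 := congrFun h ⟨0, by omega⟩
  rw [bd_row_sum, Finset.sum_add_distrib, Finset.sum_add_distrib, Finset.sum_ite_eq,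
    Finset.sum_ite_eq] at h0
  have e : ∑ k ∈ Finset.range (n+1), (if 0 = k + 1 then b 0 * bdExt n x k else 0) = 0 :=
    Finset.sum_eq_zero fun k _ => by simp
  rw [e] at h0
  have h1 : bdExt n x 0 = x ⟨0, by omega⟩ := by simp [bdExt]
  simp only [Pi.smul_apply, smul_eq_mul, ← h1, Finset.mem_range] at h0
  by_cases h2 : 0 + 1 < n + 1
  · rw [if_pos (by omega), if_pos h2] at h0
    rw [add_zero] at h0; exact h0
  · rw [if_pos (by omega), if_neg h2] at h0
    rw [bdExt_of_not_lt n x 1 (by omega)]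
    linarith

lemma bd_row_succ (n : ℕ) (a b : ℕ → ℝ) (x : Fin (n+1) → ℝ) (l : ℝ)
    (h : bdMatrix n a b *ᵥ x = l • x) (i : ℕ) (hi : i < n) :
    (a (i+1) + b (i+1)) * bdExt n x (i+1) + a (i+1) * bdExt n x (i+2) + b (i+1) * bdExt n x i
      = l * bdExt n x (i+1) := by
  have h0 := congrFun h ⟨i+1, by omega⟩
  rw [bd_row_sum, Finset.sum_add_distrib, Finset.sum_add_distrib, Finset.sum_ite_eq,
    Finset.sum_ite_eq] at h0
  simp only [Nat.add_right_cancel_iff] at h0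
  rw [Finset.sum_ite_eq] at h0
  have h1 : bdExt n x (i+1) = x ⟨i+1, by omega⟩ := by simp [bdExt, hi]
  simp only [Pi.smul_apply, smul_eq_mul, ← h1, Finset.mem_range] at h0
  rw [if_pos (by omega), if_pos (by omega : i < n + 1)] at h0
  by_cases h2 : i + 1 + 1 < n + 1
  · rw [if_pos h2] at h0; exact h0
  · rw [if_neg h2] at h0
    rw [bdExt_of_not_lt n x (i+2) (by omega)]
    linarith

lemma bd_zero_of_first (n : ℕ) (a b : ℕ → ℝ) (ha : ∀ j, j ≤ n → 0 < a j)
    (x : Fin (n+1) → ℝ) (l : ℝ) (h : bdMatrix n a b *ᵥ x = l • x) (hx : x 0 = 0) : x = 0 := by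
  have h0 : bdExt n x 0 = 0 := by simpa [bdExt] using hx
  have key : ∀ i, i ≤ n → bdExt n x i = 0 ∧ bdExt n x (i+1) = 0 := by
    intro i
    induction i with
    | zero =>
      intro _
      refine ⟨h0, ?_⟩
      have := bd_row_zero n a b x l h
      rw [h0] at this
      have ha0 := (ha 0 (by omega)).ne'
      simpa [ha0] using this
    | succ i ih =>
      intro hi
      obtain ⟨e1, e2⟩ := ih (by omega)
      refine ⟨e2, ?_⟩
      have := bd_row_succ n a b x l h i (by omega)
      rw [e1, e2] at this
      have ha0 := (ha (i+1) (by omega)).ne'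
      simpa [ha0] using this
  ext j
  have := (key j (by omega)).1
  rwa [show bdExt n x j = x j from dif_pos j.2] at this

lemma bd_pos (n : ℕ) (a b : ℕ → ℝ) (ha : ∀ j, j ≤ n → 0 < a j)
    (hb : ∀ j, 1 ≤ j → j ≤ n → 0 < b j) (hb0 : 0 ≤ b 0)
    (x : Fin (n+1) → ℝ) (l : ℝ) (h : bdMatrix n a b *ᵥ x = l • x) (hx : x ≠ 0) : 0 < l := by
  by_contra hl
  push Not at hl
  have hx0 : x 0 ≠ 0 := fun h0 => hx (bd_zero_of_first n a b ha x l h h0)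
  have hE : bdExt n x 0 = x 0 := by simp [bdExt]
  set z : ℕ → ℝ := fun i => (-1)^i * bdExt n x i / x 0 with hz
  have z0 : z 0 = 1 := by simp [hz, hE, hx0]
  have r0 : a 0 * (z 1 - z 0) = (b 0 - l) * z 0 := by
    have := bd_row_zero n a b x l h
    simp only [hz]
    field_simp
    linear_combination -this
  have rs : ∀ i, i < n → a (i+1) * (z (i+2) - z (i+1)) = b (i+1) * (z (i+1) - z i) - l * z (i+1) := by
    intro i hi
    have := bd_row_succ n a b x l h i hi
    simp only [hz]
    field_simp
    linear_combination (-1)^i * this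
  have key : ∀ i, i ≤ n → 0 < z i ∧ 0 ≤ z (i+1) - z i := by
    intro i
    induction i with
    | zero =>
      intro _
      refine ⟨by rw [z0]; norm_num, ?_⟩
      refine nonneg_of_mul_nonneg_right ?_ (ha 0 (by omega))
      show 0 ≤ a 0 * (z 1 - z 0)
      rw [r0, z0]; linarith
    | succ i ih =>
      intro hi
      obtain ⟨e1, e2⟩ := ih (by omega)
      have e3 : 0 < z (i+1) := by linarith
      refine ⟨e3, ?_⟩
      refine nonneg_of_mul_nonneg_right ?_ (ha (i+1) hi)
      show 0 ≤ a (i+1) * (z (i+2) - z (i+1))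
      rw [rs i (by omega)]
      have := mul_nonneg (hb (i+1) (by omega) hi).le e2
      have := mul_nonneg (neg_nonneg.2 hl) e3.le
      linarith
  have hend : z (n+1) = 0 := by simp [hz, bdExt]
  have := key n le_rfl
  rw [hend] at this
  linarith [this.1, this.2]

/-- Symmetrizing weights. -/
noncomputable def bdW (a b : ℕ → ℝ) : ℕ → ℝ
  | 0 => 1
  | i+1 => bdW a b i * Real.sqrt (a i / b (i+1))

lemma bdW_pos (n : ℕ) (a b : ℕ → ℝ) (ha : ∀ j, j ≤ n → 0 < a j)
    (hb : ∀ j, 1 ≤ j → j ≤ n → 0 < b j) : ∀ i, i ≤ n → 0 < bdW a b i := by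
  intro i
  induction i with
  | zero => intro _; simp [bdW]
  | succ i ih =>
    intro hi
    exact mul_pos (ih (by omega))
      (Real.sqrt_pos.2 (div_pos (ha i (by omega)) (hb (i+1) (by omega) hi)))

lemma bdW_step (n : ℕ) (a b : ℕ → ℝ) (ha : ∀ j, j ≤ n → 0 < a j)
    (hb : ∀ j, 1 ≤ j → j ≤ n → 0 < b j) (i : ℕ) (hi : i + 1 ≤ n) :
    bdW a b i * a i / bdW a b (i+1) = bdW a b (i+1) * b (i+1) / bdW a b i := by
  have h1 := bdW_pos n a b ha hb i (by omega)
  have h2 := bdW_pos n a b ha hb (i+1) hi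
  have hb' := hb (i+1) (by omega) hi
  rw [div_eq_div_iff h2.ne' h1.ne']
  have hs := Real.sq_sqrt (div_pos (ha i (by omega)) hb').le
  have : bdW a b (i+1) = bdW a b i * Real.sqrt (a i / b (i+1)) := rfl
  rw [this]
  have e : a i = Real.sqrt (a i / b (i+1)) ^ 2 * b (i+1) := by rw [hs]; field_simp
  linear_combination (bdW a b i)^2 * e

/-- The symmetrized matrix. -/
noncomputable def bdS (n : ℕ) (a b : ℕ → ℝ) : Matrix (Fin (n+1)) (Fin (n+1)) ℝ :=
  Matrix.diagonal (fun i : Fin (n+1) => bdW a b i) * bdMatrix n a b *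
    Matrix.diagonal (fun i : Fin (n+1) => (bdW a b i)⁻¹)

lemma bdS_herm (n : ℕ) (a b : ℕ → ℝ) (ha : ∀ j, j ≤ n → 0 < a j)
    (hb : ∀ j, 1 ≤ j → j ≤ n → 0 < b j) : (bdS n a b).IsHermitian := by
  apply Matrix.IsHermitian.ext
  intro i j
  simp only [bdS, Matrix.mul_diagonal, Matrix.diagonal_mul, star_trivial, bdMatrix, Matrix.of_apply,
    ← div_eq_mul_inv]
  obtain ⟨i, hi⟩ := i
  obtain ⟨j, hj⟩ := j
  simp only
  by_cases h1 : i = j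
  · subst h1; rfl
  · by_cases h2 : j = i + 1
    · subst h2
      rw [if_neg (by omega), if_neg (by omega), if_pos rfl, if_neg (by omega), if_pos rfl]
      exact (bdW_step n a b ha hb i (by omega)).symm
    · by_cases h3 : i = j + 1
      · subst h3
        rw [if_neg (by omega), if_pos rfl, if_neg (by omega), if_neg (by omega), if_pos rfl]
        exact bdW_step n a b ha hb j (by omega)
      · rw [if_neg (by omega), if_neg h3, if_neg h2, if_neg h1, if_neg h2, if_neg h3]
        simp

lemma bd_diag_inv (n : ℕ) (a b : ℕ → ℝ) (ha : ∀ j, j ≤ n → 0 < a j)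
    (hb : ∀ j, 1 ≤ j → j ≤ n → 0 < b j) :
    Matrix.diagonal (fun i : Fin (n+1) => (bdW a b i)⁻¹) *
      Matrix.diagonal (fun i : Fin (n+1) => bdW a b i) = 1 := by
  rw [Matrix.diagonal_mul_diagonal, ← Matrix.diagonal_one]
  congr 1
  ext i
  exact inv_mul_cancel₀ (bdW_pos n a b ha hb i (by omega)).ne'

lemma bdS_charpoly (n : ℕ) (a b : ℕ → ℝ) (ha : ∀ j, j ≤ n → 0 < a j)
    (hb : ∀ j, 1 ≤ j → j ≤ n → 0 < b j) : (bdS n a b).charpoly = (bdMatrix n a b).charpoly := by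
  rw [bdS, Matrix.charpoly_mul_comm, ← Matrix.mul_assoc, bd_diag_inv n a b ha hb, Matrix.one_mul]

lemma bdS_eig (n : ℕ) (a b : ℕ → ℝ) (ha : ∀ j, j ≤ n → 0 < a j)
    (hb : ∀ j, 1 ≤ j → j ≤ n → 0 < b j) (v : Fin (n+1) → ℝ) (l : ℝ)
    (h : bdS n a b *ᵥ v = l • v) :
    bdMatrix n a b *ᵥ (Matrix.diagonal (fun i : Fin (n+1) => (bdW a b i)⁻¹) *ᵥ v) =
      l • (Matrix.diagonal (fun i : Fin (n+1) => (bdW a b i)⁻¹) *ᵥ v) := by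
  rw [← Matrix.mulVec_smul, ← h, Matrix.mulVec_mulVec, Matrix.mulVec_mulVec, bdS,
    ← Matrix.mul_assoc, ← Matrix.mul_assoc, bd_diag_inv n a b ha hb, Matrix.one_mul]

lemma bd_diag_zero (n : ℕ) (a b : ℕ → ℝ) (ha : ∀ j, j ≤ n → 0 < a j)
    (hb : ∀ j, 1 ≤ j → j ≤ n → 0 < b j) (v : Fin (n+1) → ℝ)
    (h : Matrix.diagonal (fun i : Fin (n+1) => (bdW a b i)⁻¹) *ᵥ v = 0) : v = 0 := by
  ext i
  have := congrFun h i
  rw [Matrix.mulVec_diagonal] at this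
  have hp := (inv_pos.2 (bdW_pos n a b ha hb i (by omega))).ne'
  simpa [(bdW_pos n a b ha hb i (by omega)).ne'] using this

lemma bdS_zero_of_first (n : ℕ) (a b : ℕ → ℝ) (ha : ∀ j, j ≤ n → 0 < a j)
    (hb : ∀ j, 1 ≤ j → j ≤ n → 0 < b j) (v : Fin (n+1) → ℝ) (l : ℝ)
    (h : bdS n a b *ᵥ v = l • v) (hv : v 0 = 0) : v = 0 := by
  apply bd_diag_zero n a b ha hb
  apply bd_zero_of_first n a b ha _ l (bdS_eig n a b ha hb v l h)
  rw [Matrix.mulVec_diagonal, hv, mul_zero]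

lemma bd_main (n : ℕ) (a b : ℕ → ℝ) (ha : ∀ j, j ≤ n → 0 < a j)
    (hb : ∀ j, 1 ≤ j → j ≤ n → 0 < b j) (hb0 : 0 ≤ b 0) :
    ∃ μ : Fin (n+1) → ℝ, StrictMono μ ∧ (∀ i, 0 < μ i) ∧
      (bdMatrix n a b).charpoly = ∏ i : Fin (n+1), (X - C (μ i)) := by
  have hS := bdS_herm n a b ha hb
  have hne : ∀ i, (hS.eigenvectorBasis i).ofLp ≠ 0 := by
    intro i h0
    have h1 := hS.eigenvectorBasis.orthonormal.ne_zero i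
    exact h1 (by ext k; exact congrFun h0 k)
  have hpos : ∀ i, 0 < hS.eigenvalues i := fun i =>
    bd_pos n a b ha hb hb0 _ _ (bdS_eig n a b ha hb _ _ (hS.mulVec_eigenvectorBasis i))
      (fun h0 => hne i (bd_diag_zero n a b ha hb _ h0))
  have hinj : Function.Injective hS.eigenvalues := by
    intro i j hij
    by_contra hne'
    set v := hS.eigenvectorBasis i with hv
    set w := hS.eigenvectorBasis j with hw
    have ev := hS.mulVec_eigenvectorBasis i
    have ew := hS.mulVec_eigenvectorBasis j
    rw [← hv] at ev
    rw [← hw, ← hij] at ew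
    have hv0 : v.ofLp 0 ≠ 0 := fun h0 => hne i (bdS_zero_of_first n a b ha hb _ _ ev h0)
    have hu : w.ofLp 0 • v.ofLp - v.ofLp 0 • w.ofLp = 0 := by
      apply bdS_zero_of_first n a b ha hb _ (hS.eigenvalues i)
      · rw [Matrix.mulVec_sub, Matrix.mulVec_smul, Matrix.mulVec_smul, ev, ew, smul_sub,
          smul_comm, smul_comm (v.ofLp 0)]
      · simp [mul_comm]
    have hu' : w.ofLp 0 • v = v.ofLp 0 • w := by
      ext k
      have := congrFun hu k
      simp at this ⊢
      linarith
    have h1 := congrArg (fun y => inner ℝ w y) hu'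
    simp only [inner_smul_right] at h1
    have h2 : inner ℝ w v = 0 := hS.eigenvectorBasis.orthonormal.2 (Ne.symm hne')
    have h3 : inner ℝ w w = (1:ℝ) := by
      rw [real_inner_self_eq_norm_sq, hS.eigenvectorBasis.orthonormal.1 j]; norm_num
    rw [h2, h3] at h1
    apply hv0
    linarith
  have hcard : (Finset.univ.image hS.eigenvalues).card = n + 1 := by
    rw [Finset.card_image_of_injective _ hinj]; simp
  refine ⟨(Finset.univ.image hS.eigenvalues).orderEmbOfFin hcard, OrderEmbedding.strictMono _, ?_, ?_⟩
  · intro i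
    have := Finset.orderEmbOfFin_mem (Finset.univ.image hS.eigenvalues) hcard i
    obtain ⟨k, _, hk⟩ := Finset.mem_image.1 this
    rw [← hk]; exact hpos k
  · rw [← bdS_charpoly n a b ha hb, hS.charpoly_eq]
    have h1 : ∏ i, (X - C (hS.eigenvalues i)) =
        ∏ y ∈ Finset.univ.image hS.eigenvalues, (X - C y) :=
      (Finset.prod_image (f := fun y : ℝ => X - C y) (fun x _ y _ h => hinj h)).symm
    have h2 : ∏ i, (X - C ((Finset.univ.image hS.eigenvalues).orderEmbOfFin hcard i)) =
        ∏ y ∈ Finset.univ.image ((Finset.univ.image hS.eigenvalues).orderEmbOfFin hcard),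
          (X - C y) :=
      (Finset.prod_image (f := fun y : ℝ => X - C y) (fun x _ y _ h => (OrderEmbedding.strictMono _).injective h)).symm
    rw [h2, Finset.image_orderEmbOfFin_univ, ← h1]
    rfl

/-- For every fixed `t ∈ I`, all eigenvalues of the birth and death matrix `A(t)` are
real, pairwise distinct (simple), and strictly positive: the characteristic polynomial
splits over `ℝ` with strictly increasing, strictly positive roots. -/
theorem stmt0 (n : ℕ) (hn : 0 < n) (I : Set ℝ) (hIopen : IsOpen I)
    (hIconn : I.OrdConnected) (hIne : I.Nonempty)
    (a b : ℕ → ℝ → ℝ)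
    (ha_diff : ∀ j, j ≤ n → ContDiffOn ℝ 1 (a j) I)
    (hb_diff : ∀ j, j ≤ n → ContDiffOn ℝ 1 (b j) I)
    (ha_pos : ∀ t ∈ I, ∀ j, j ≤ n → 0 < a j t)
    (hb_pos : ∀ t ∈ I, ∀ j, 1 ≤ j → j ≤ n → 0 < b j t)
    (hb0 : ∀ t ∈ I, 0 ≤ b 0 t) :
    ∀ t ∈ I, ∃ μ : Fin (n+1) → ℝ, StrictMono μ ∧ (∀ i, 0 < μ i) ∧
      (bdMatrix n (fun j => a j t) (fun j => b j t)).charpoly =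
        ∏ i : Fin (n+1), (X - C (μ i)) := by
  intro t ht
  exact bd_main n _ _ (ha_pos t ht) (hb_pos t ht) (hb0 t ht)
end

section
/- Let {q_j(x;t)} be the orthogonal polynomials associated with the symmetrized birth and death matrix: q_{−1}(x;t)=0, q_0(x;t)=1, and √(a_j(t)b_{j+1}(t))·q_{j+1}(x;t) = (x−(a_j(t)+b_j(t)))·q_j(x;t) − √(a_{j−1}(t)b_j(t))·q_{j−1}(x;t). Then for all j ≥ 1 and t ∈ I, q_j(0;t) = (−1)^j · ( Σ_{k=0}^{j} ∏_{i=k}^{j−1} a_i(t) · ∏_{i=0}^{k−1} b_i(t) ) / √( ∏_{k=0}^{j−1} a_k(t) · ∏_{k=1}^{j} b_k(t) ), where empty products equal 1; in particular sgn(q_j(0;t)) = (−1)^j whenever b_0(t) ≥ 0 and the numerator is positive. -/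
open Matrix Polynomial

theorem stmt12_sum_succ (A B : ℕ → ℝ) (j : ℕ) :
    (∑ k ∈ Finset.range (j+1+1),
        (∏ i ∈ Finset.Ico k (j+1), A i) * ∏ i ∈ Finset.range k, B i) =
      A j * (∑ k ∈ Finset.range (j+1),
        (∏ i ∈ Finset.Ico k j, A i) * ∏ i ∈ Finset.range k, B i)
      + ∏ i ∈ Finset.range (j+1), B i := by
  rw [Finset.sum_range_succ, Finset.mul_sum]
  congr 1
  · refine Finset.sum_congr rfl fun k hk => ?_
    have hk' : k ≤ j := by
      have := Finset.mem_range.mp hk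
      omega
    rw [Finset.prod_Ico_succ_top hk']
    ring
  · simp

theorem stmt12_aux (A B Q S s P : ℕ → ℝ)
    (hS : ∀ j, S j = ∑ k ∈ Finset.range (j+1),
        (∏ i ∈ Finset.Ico k j, A i) * ∏ i ∈ Finset.range k, B i)
    (hs : ∀ j, s j * s j = A j * B (j+1))
    (hP0 : P 0 = 1) (hP : ∀ j, P (j+1) = P j * s j)
    (hQ0 : Q 0 = 1) (hQ1 : s 0 * Q 1 = -(A 0 + B 0))
    (hQ : ∀ j, s (j+1) * Q (j+2) = -(A (j+1) + B (j+1)) * Q (j+1) - s j * Q j) (j : ℕ) :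
    Q j * P j = (-1)^j * S j ∧ Q (j+1) * P (j+1) = (-1)^(j+1) * S (j+1) := by
  have h1 : ∀ j, S (j+1) = A j * S j + ∏ i ∈ Finset.range (j+1), B i := by
    intro j
    rw [hS, hS, stmt12_sum_succ]
  have hS0 : S 0 = 1 := by simp [hS]
  induction j with
  | zero =>
    refine ⟨by simp [hQ0, hP0, hS0], ?_⟩
    rw [h1, hP, hP0, hS0]
    simp
    linarith
  | succ j ih =>
    obtain ⟨ih1, ih2⟩ := ih
    refine ⟨ih2, ?_⟩
    have e1 := h1 j
    have e2 := h1 (j+1)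
    rw [Finset.prod_range_succ] at e2
    have e3 := hP j
    have e4 := hP (j+1)
    have e5 := hQ j
    have e6 := hs j
    have g : Q (j+1+1) * P (j+1+1) = P (j+1) * (s (j+1) * Q (j+2)) := by
      rw [e4]; ring
    rw [g, e5, e2]
    have g2 : P (j+1) * (s j * Q j) = A j * B (j+1) * ((-1)^j * S j) := by
      rw [e3, ← ih1, ← e6]; ring
    have g3 : ∏ i ∈ Finset.range (j+1), B i = S (j+1) - A j * S j := by linarith
    rw [g3]
    calc _ = -(A (j+1) + B (j+1)) * (Q (j+1) * P (j+1)) - P (j+1) * (s j * Q j) := by ring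
      _ = _ := by rw [ih2, g2]; ring

/-- For all `j ≥ 1` and `t ∈ I`, the orthogonal polynomials `q_j` associated with the
symmetrized birth and death matrix satisfy
`q_j(0;t) = (−1)^j (Σ_{k=0}^{j} ∏_{i=k}^{j−1} a_i(t) ∏_{i=0}^{k−1} b_i(t)) /
  √(∏_{k=0}^{j−1} a_k(t) ∏_{k=1}^{j} b_k(t))`,
and in particular `sgn(q_j(0;t)) = (−1)^j` whenever the numerator is positive. -/
theorem stmt12 (I : Set ℝ) (hIopen : IsOpen I) (hIconn : I.OrdConnected) (hIne : I.Nonempty)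
    (a b : ℤ → ℝ → ℝ)
    (hneg : ∀ j : ℤ, j < 0 → ∀ t : ℝ, a j t = 0 ∧ b j t = 0)
    (hapos : ∀ t ∈ I, ∀ j : ℤ, 0 ≤ j → 0 < a j t)
    (hbpos : ∀ t ∈ I, ∀ j : ℤ, 1 ≤ j → 0 < b j t)
    (hb0 : ∀ t ∈ I, 0 ≤ b 0 t)
    (q : ℤ → ℝ → ℝ → ℝ)
    (hqm1 : ∀ x t : ℝ, q (-1) x t = 0)
    (hq0 : ∀ x t : ℝ, q 0 x t = 1)
    (hqrec : ∀ j : ℤ, 0 ≤ j → ∀ x : ℝ, ∀ t ∈ I,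
      Real.sqrt (a j t * b (j+1) t) * q (j+1) x t =
        (x - (a j t + b j t)) * q j x t - Real.sqrt (a (j-1) t * b j t) * q (j-1) x t) :
    ∀ t ∈ I, ∀ j : ℕ, 1 ≤ j →
      q (j : ℤ) 0 t = (-1)^j *
        ((∑ k ∈ Finset.range (j+1),
            (∏ i ∈ Finset.Ico k j, a (i : ℤ) t) * ∏ i ∈ Finset.range k, b (i : ℤ) t) /
          Real.sqrt ((∏ k ∈ Finset.range j, a (k : ℤ) t) *
            ∏ k ∈ Finset.range j, b ((k : ℤ) + 1) t)) ∧
      (0 < ∑ k ∈ Finset.range (j+1),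
            (∏ i ∈ Finset.Ico k j, a (i : ℤ) t) * ∏ i ∈ Finset.range k, b (i : ℤ) t →
        Real.sign (q (j : ℤ) 0 t) = (-1)^j) := by
  intro t ht j _
  have hA : ∀ i : ℕ, 0 < a (i : ℤ) t := fun i => hapos t ht _ (by omega)
  have hB : ∀ i : ℕ, 0 < b ((i : ℤ) + 1) t := fun i => hbpos t ht _ (by omega)
  have hPpos : ∀ j : ℕ, 0 < (∏ k ∈ Finset.range j, a (k : ℤ) t) *
            ∏ k ∈ Finset.range j, b ((k : ℤ) + 1) t := fun j =>
    mul_pos (Finset.prod_pos fun i _ => hA i) (Finset.prod_pos fun i _ => hB i)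
  have key := (stmt12_aux (fun i => a (i : ℤ) t) (fun i => b (i : ℤ) t)
    (fun i => q (i : ℤ) 0 t) _ (fun i => Real.sqrt (a (i : ℤ) t * b ((i : ℤ) + 1) t))
    (fun j => Real.sqrt ((∏ k ∈ Finset.range j, a (k : ℤ) t) *
            ∏ k ∈ Finset.range j, b ((k : ℤ) + 1) t)) (fun _ => rfl)
    (fun i => by
      have := Real.mul_self_sqrt (mul_pos (hA i) (hB i)).le
      simpa using this)
    (by simp)
    (fun i => by
      rw [← Real.sqrt_mul (hPpos i).le, Finset.prod_range_succ, Finset.prod_range_succ]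
      congr 1
      ring)
    (by simpa using hq0 0 t)
    (by
      have := hqrec 0 le_rfl 0 t ht
      simp [hq0, hqm1] at this
      simp
      linarith)
    (fun i => by
      have := hqrec ((i : ℤ) + 1) (by omega) 0 t ht
      have e : (i : ℤ) + 1 + 1 = (i : ℤ) + 2 := by ring
      simp only [add_sub_cancel_right, zero_sub, e] at this
      push_cast
      rw [e]
      exact this) j).1
  have hs := Real.sqrt_pos.mpr (hPpos j)
  have main := (eq_div_iff hs.ne').mpr key
  rw [mul_div_assoc] at main
  refine ⟨main, fun hpos => ?_⟩
  have hd := div_pos hpos hs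
  rw [main]
  rcases neg_one_pow_eq_or ℝ j with h | h
  · rw [h, one_mul, Real.sign_of_pos hd]
  · rw [h, Real.sign_of_neg (by linarith)]
end

section
/- Let A↑_0 = {t ∈ I : a′_j(t) > 0 and a′_j(t)b_j(t) = a_j(t)b′_j(t) for j = 0,…,n} and A↑_1 = {t ∈ I : a′_0(t) > 0, and for j = 1,…,n, a′_j(t) > 0 and a′_{j−1}(t)b_j(t) = a_{j−1}(t)b′_j(t)}, and define A↓_0, A↓_1 analogously with < in place of >. If t ∈ A↑_0 ∩ A↑_1, then A′(t)·A(t) = A(t)·A′(t), and 0 < λ_0(A′(t)) = λ′_0(A,t) < λ_1(A′(t)) = λ′_1(A,t) < … < λ_n(A′(t)) = λ′_n(A,t); if t ∈ A↓_0 ∩ A↓_1, then A′(t) and A(t) commute and 0 > λ_0(A′(t)) = λ′_0(A,t) > … > λ_n(A′(t)) = λ′_n(A,t). -/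
open Matrix Polynomial

/-- `μ` is an eigenvalue of the real matrix `M` (with a real eigenvector). -/
def IsEigR {N : Type*} [Fintype N] (M : Matrix N N ℝ) (μ : ℝ) : Prop :=
  ∃ v : N → ℝ, v ≠ 0 ∧ M.mulVec v = μ • v

/-- `A↑_0 = {t ∈ I : a′_j(t) > 0 and a′_j(t) b_j(t) = a_j(t) b′_j(t), j = 0,…,n}`. -/
def Aup0 (n : ℕ) (a b a' b' : ℕ → ℝ → ℝ) (I : Set ℝ) : Set ℝ :=
  {t ∈ I | ∀ j, j ≤ n → 0 < a' j t ∧ a' j t * b j t = a j t * b' j t}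

/-- `A↑_1`. -/
def Aup1 (n : ℕ) (a b a' b' : ℕ → ℝ → ℝ) (I : Set ℝ) : Set ℝ :=
  {t ∈ I | 0 < a' 0 t ∧ ∀ j, 1 ≤ j → j ≤ n →
    0 < a' j t ∧ a' (j-1) t * b j t = a (j-1) t * b' j t}

/-- `A↓_0` (with `<` in place of `>`). -/
def Adown0 (n : ℕ) (a b a' b' : ℕ → ℝ → ℝ) (I : Set ℝ) : Set ℝ :=
  {t ∈ I | ∀ j, j ≤ n → a' j t < 0 ∧ a' j t * b j t = a j t * b' j t}

/-- `A↓_1` (with `<` in place of `>`). -/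
def Adown1 (n : ℕ) (a b a' b' : ℕ → ℝ → ℝ) (I : Set ℝ) : Set ℝ :=
  {t ∈ I | a' 0 t < 0 ∧ ∀ j, 1 ≤ j → j ≤ n →
    a' j t < 0 ∧ a' (j-1) t * b j t = a (j-1) t * b' j t}

theorem bd_mulVec (n : ℕ) (a b : ℕ → ℝ) (V : ℕ → ℝ) (hV : ∀ i, n < i → V i = 0)
    (i : ℕ) (hi : i < n + 1) :
    (bdMatrix n a b).mulVec (fun j => V j.1) ⟨i, hi⟩ =
      (a i + b i) * V i + a i * V (i + 1) + (if i = 0 then 0 else b i * V (i - 1)) := by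
  have h1 : (bdMatrix n a b).mulVec (fun j => V j.1) ⟨i, hi⟩ =
      ∑ j ∈ Finset.range (n + 1), ((if j = i then (a i + b i) * V j else 0)
        + (if j = i + 1 then a i * V j else 0)
        + (if j = i - 1 then (if i = 0 then 0 else b i * V j) else 0)) := by
    rw [Finset.sum_range]
    simp only [Matrix.mulVec, dotProduct, bdMatrix, Matrix.of_apply]
    refine Finset.sum_congr rfl fun j _ => ?_
    split_ifs <;> first | omega | simp
  rw [h1, Finset.sum_add_distrib, Finset.sum_add_distrib]
  simp only [Finset.sum_ite_eq', Finset.mem_range]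
  rw [if_pos hi, if_pos (show i - 1 < n + 1 by omega)]
  congr 2
  split_ifs with h
  · rfl
  · rw [hV (i + 1) (by omega), mul_zero]

theorem bd_eig_pos (n : ℕ) (a b : ℕ → ℝ) (ha : ∀ j, j ≤ n → 0 < a j)
    (hb : ∀ j, 1 ≤ j → j ≤ n → 0 < b j) (hb0 : 0 ≤ b 0) (μ : ℝ)
    (h : IsEigR (bdMatrix n a b) μ) : 0 < μ := by
  obtain ⟨v, hv0, hv⟩ := h
  by_contra hμ
  push Not at hμ
  set V : ℕ → ℝ := fun i => if h : i < n + 1 then v ⟨i, h⟩ else 0 with hVdef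
  have hvV : v = fun j => V j.1 := by
    funext j
    simp only [hVdef]
    rw [dif_pos j.2]
  have hV : ∀ i, n < i → V i = 0 := by
    intro i hi
    simp only [hVdef]
    rw [dif_neg (by omega)]
  have key : ∀ i, i ≤ n → (a i + b i) * V i + a i * V (i + 1)
      + (if i = 0 then 0 else b i * V (i - 1)) = μ * V i := by
    intro i hi
    rw [← bd_mulVec n a b V hV i (by omega), ← hvV, hv]
    simp [hvV]
  -- first entry nonzero
  have h0 : V 0 ≠ 0 := by
    intro h0
    have hz : ∀ i, i ≤ n → V i = 0 ∧ V (i + 1) = 0 := by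
      intro i
      induction i with
      | zero =>
        intro _
        refine ⟨h0, ?_⟩
        have := key 0 (by omega)
        simp only [h0, if_true, mul_zero, zero_add, add_zero] at this
        exact (mul_eq_zero.mp this).resolve_left (ha 0 (by omega)).ne'
      | succ i ih =>
        intro hi
        obtain ⟨h1, h2⟩ := ih (by omega)
        refine ⟨h2, ?_⟩
        have := key (i + 1) hi
        simp [h1, h2] at this
        exact this.resolve_left (ha _ hi).ne'
    apply hv0
    rw [hvV]
    funext j
    exact (hz j.1 (by omega)).1
  -- signed, normalized sequence
  set W : ℕ → ℝ := fun i => (-1) ^ i * V i * V 0 with hW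
  have hW0 : 0 < W 0 := by
    simp only [hW, pow_zero, one_mul]
    exact mul_self_pos.mpr h0
  have step : ∀ i, i ≤ n → 0 < W i ∧ W i ≤ W (i + 1) := by
    intro i
    induction i with
    | zero =>
      intro _
      refine ⟨hW0, ?_⟩
      have k := key 0 (by omega)
      have ha0 := ha 0 (by omega)
      have e : a 0 * (W 1 - W 0) = (b 0 - μ) * W 0 := by
        simp only [hW, if_true] at k ⊢
        linear_combination (-V 0) * k
      have : 0 ≤ a 0 * (W 1 - W 0) := by
        rw [e]; exact mul_nonneg (by linarith) hW0.le
      have := nonneg_of_mul_nonneg_right this ha0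
      simpa using this
    | succ i ih =>
      intro hi
      obtain ⟨h1, h2⟩ := ih (by omega)
      refine ⟨by linarith, ?_⟩
      have k := key (i + 1) hi
      have ha0 := ha (i + 1) hi
      have hb1 := hb (i + 1) (by omega) hi
      have e : a (i + 1) * (W (i + 2) - W (i + 1)) =
          b (i + 1) * (W (i + 1) - W i) + (- μ) * W (i + 1) := by
        simp only [hW, Nat.add_eq_zero_iff, one_ne_zero, and_false, if_false,
          Nat.add_sub_cancel] at k ⊢
        linear_combination ((-1) ^ i * V 0) * k
      have : 0 ≤ a (i + 1) * (W (i + 2) - W (i + 1)) := by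
        rw [e]
        exact add_nonneg (mul_nonneg hb1.le (by linarith)) (mul_nonneg (by linarith) (by linarith))
      have := nonneg_of_mul_nonneg_right this ha0
      linarith
  obtain ⟨h1, h2⟩ := step n le_rfl
  have : W (n + 1) = 0 := by simp [hW, hV (n + 1) (by omega)]
  linarith

theorem det_eq_prod_of_eigs (n : ℕ) (M : Matrix (Fin (n+1)) (Fin (n+1)) ℝ)
    (l : Fin (n+1) → ℝ) (hinj : Function.Injective l) (hl : ∀ k, IsEigR M (l k)) (μ : ℝ) :
    (Matrix.scalar (Fin (n+1)) μ - M).det = ∏ k, (μ - l k) := by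
  have hroot : ∀ k, M.charpoly.eval (l k) = 0 := by
    intro k
    obtain ⟨v, hv0, hv⟩ := hl k
    rw [Matrix.eval_charpoly]
    apply Matrix.exists_mulVec_eq_zero_iff.mp
    refine ⟨v, hv0, ?_⟩
    rw [Matrix.sub_mulVec, hv]
    ext i
    simp [Matrix.scalar_apply, Matrix.mulVec_diagonal]
  have hp : M.charpoly = ∏ k, (X - C (l k)) := by
    have hdvd : (∏ k, (X - C (l k))) ∣ M.charpoly := by
      apply Finset.prod_dvd_of_coprime
      · intro i _ j _ hij
        exact Polynomial.isCoprime_X_sub_C_of_isUnit_sub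
          (sub_ne_zero.mpr (hinj.ne hij)).isUnit
      · intro k _
        exact Polynomial.dvd_iff_isRoot.mpr (hroot k)
    refine (Polynomial.eq_of_monic_of_dvd_of_natDegree_le
      (Polynomial.monic_prod_of_monic _ _ fun k _ => Polynomial.monic_X_sub_C _)
      (Matrix.charpoly_monic M) hdvd ?_)
    rw [Matrix.charpoly_natDegree_eq_dim, Polynomial.natDegree_prod_of_monic _ _
      (fun k _ => Polynomial.monic_X_sub_C _)]
    simp
  rw [← Matrix.eval_charpoly, hp, Polynomial.eval_prod]
  simp

theorem det_hasDerivAt_same {m : ℕ} (M N : ℝ → Matrix (Fin m) (Fin m) ℝ)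
    (D : Matrix (Fin m) (Fin m) ℝ) (t : ℝ)
    (hM : ∀ i j, HasDerivAt (fun s => M s i j) (D i j) t)
    (hN : ∀ i j, HasDerivAt (fun s => N s i j) (D i j) t) (h : M t = N t) :
    ∃ d, HasDerivAt (fun s => (M s).det) d t ∧ HasDerivAt (fun s => (N s).det) d t := by
  have gen : ∀ K : ℝ → Matrix (Fin m) (Fin m) ℝ,
      (∀ i j, HasDerivAt (fun s => K s i j) (D i j) t) →
      HasDerivAt (fun s => (K s).det) (∑ σ : Equiv.Perm (Fin m),
        ((Equiv.Perm.sign σ : ℤ) : ℝ) *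
          ∑ i, (∏ j ∈ Finset.univ.erase i, K t (σ j) j) • D (σ i) i) t := by
    intro K hK
    simp only [Matrix.det_apply']
    refine HasDerivAt.fun_sum fun σ _ => HasDerivAt.const_mul _ ?_
    exact HasDerivAt.fun_finsetProd fun i _ => hK (σ i) i
  refine ⟨_, gen M hM, ?_⟩
  rw [h]
  exact gen N hN

theorem prod_hasDerivAt_zero {m : ℕ} (f : Fin m → ℝ → ℝ) (f' : Fin m → ℝ) (t : ℝ)
    (hf : ∀ k, HasDerivAt (f k) (f' k) t) (k : Fin m) (hk : f k t = 0) :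
    HasDerivAt (fun s => ∏ j, f j s) ((∏ j ∈ Finset.univ.erase k, f j t) * f' k) t := by
  have := HasDerivAt.fun_finsetProd (u := Finset.univ) (fun i _ => hf i)
  refine this.congr_deriv ?_
  rw [Finset.sum_eq_single k]
  · simp
  · intro i _ hi
    rw [Finset.prod_eq_zero (i := k) (by simp [hi.symm]) hk, zero_smul]
  · simp

theorem lam_deriv (n : ℕ) (I : Set ℝ) (hI : IsOpen I)
    (A : ℝ → Matrix (Fin (n+1)) (Fin (n+1)) ℝ) (t c : ℝ) (ht : t ∈ I)
    (hA : ∀ i j, HasDerivAt (fun s => A s i j) (c * A t i j) t)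
    (lam lam' : Fin (n+1) → ℝ → ℝ)
    (hlam : ∀ t ∈ I, StrictMono (fun k : Fin (n+1) => lam k t) ∧ ∀ k, IsEigR (A t) (lam k t))
    (hlamd : ∀ k, ∀ t ∈ I, HasDerivAt (lam k) (lam' k t) t) (k : Fin (n+1)) :
    lam' k t = c * lam k t := by
  set μ := lam k t with hμ
  have hr : HasDerivAt (fun s => 1 + c * (s - t)) c t := by
    simpa using (((hasDerivAt_id t).sub_const t).const_mul c).const_add 1
  obtain ⟨d, hd1, hd2⟩ := det_hasDerivAt_same
    (fun s => Matrix.scalar (Fin (n+1)) μ - A s)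
    (fun s => Matrix.scalar (Fin (n+1)) μ - (1 + c * (s - t)) • A t)
    (-(c • A t)) t
    (by
      intro i j
      simpa using (hA i j).const_sub (Matrix.scalar (Fin (n+1)) μ i j))
    (by
      intro i j
      simpa using (hr.mul_const (A t i j)).const_sub (Matrix.scalar (Fin (n+1)) μ i j))
    (by simp)
  have e1 : HasDerivAt (fun s => ∏ j, (μ - lam j s)) d t := by
    refine hd1.congr_of_eventuallyEq ?_
    filter_upwards [hI.mem_nhds ht] with s hs
    exact (det_eq_prod_of_eigs n (A s) _ (hlam s hs).1.injective (hlam s hs).2 μ).symm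
  have e2 : HasDerivAt (fun s => ∏ j, (μ - (1 + c * (s - t)) * lam j t)) d t := by
    refine hd2.congr_of_eventuallyEq ?_
    have : ∀ᶠ s in nhds t, 1 + c * (s - t) ≠ 0 :=
      hr.continuousAt.eventually_ne (by simp)
    filter_upwards [this] with s hs
    refine (det_eq_prod_of_eigs n _ (fun j => (1 + c * (s - t)) * lam j t) ?_ ?_ μ).symm
    · intro i j hij
      exact (hlam t ht).1.injective (mul_left_cancel₀ hs hij)
    · intro j
      obtain ⟨v, hv0, hv⟩ := (hlam t ht).2 j
      exact ⟨v, hv0, by rw [Matrix.smul_mulVec, hv, smul_smul]⟩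
  have f1 := prod_hasDerivAt_zero (fun j s => μ - lam j s) (fun j => -lam' j t) t
    (fun j => (hlamd j t ht).const_sub μ) k (by simp [hμ])
  have f2 := prod_hasDerivAt_zero (fun j s => μ - (1 + c * (s - t)) * lam j t)
    (fun j => -(c * lam j t)) t
    (fun j => (hr.mul_const (lam j t)).const_sub μ) k (by simp [hμ])
  have g := (e1.unique f1).symm.trans (e2.unique f2)
  simp only [sub_self, mul_zero, add_zero, one_mul] at g
  have hne : ∏ j ∈ Finset.univ.erase k, (μ - lam j t) ≠ 0 := by
    refine Finset.prod_ne_zero_iff.mpr fun j hj => sub_ne_zero.mpr ?_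
    exact (hlam t ht).1.injective.ne (Finset.ne_of_mem_erase hj).symm
  have := mul_left_cancel₀ hne g
  linarith

theorem bd_core (n : ℕ) (I : Set ℝ) (hIopen : IsOpen I)
    (a b a' b' : ℕ → ℝ → ℝ)
    (hapos : ∀ t ∈ I, ∀ j, j ≤ n → 0 < a j t)
    (hbpos : ∀ t ∈ I, ∀ j, 1 ≤ j → j ≤ n → 0 < b j t)
    (hb0 : ∀ t ∈ I, 0 ≤ b 0 t)
    (had : ∀ j, ∀ t ∈ I, HasDerivAt (a j) (a' j t) t)
    (hbd : ∀ j, ∀ t ∈ I, HasDerivAt (b j) (b' j t) t)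
    (lam lam' : Fin (n+1) → ℝ → ℝ)
    (hlam : ∀ t ∈ I, StrictMono (fun k : Fin (n+1) => lam k t) ∧
      ∀ k, IsEigR (bdMatrix n (fun j => a j t) (fun j => b j t)) (lam k t))
    (hlamd : ∀ k, ∀ t ∈ I, HasDerivAt (lam k) (lam' k t) t)
    (t : ℝ) (ht : t ∈ I)
    (h0 : ∀ j, j ≤ n → a' j t * b j t = a j t * b' j t)
    (h1 : ∀ j, 1 ≤ j → j ≤ n → a' (j-1) t * b j t = a (j-1) t * b' j t) :
    bdMatrix n (fun j => a' j t) (fun j => b' j t) *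
          bdMatrix n (fun j => a j t) (fun j => b j t) =
        bdMatrix n (fun j => a j t) (fun j => b j t) *
          bdMatrix n (fun j => a' j t) (fun j => b' j t) ∧
    (∀ k, IsEigR (bdMatrix n (fun j => a' j t) (fun j => b' j t)) (lam' k t)) ∧
    (∀ k, 0 < lam k t) ∧ ∀ k, lam' k t = (a' 0 t / a 0 t) * lam k t := by
  set c := a' 0 t / a 0 t with hc
  have hca : ∀ j, j ≤ n → a' j t = c * a j t := by
    intro j
    induction j with
    | zero => intro _; rw [hc, div_mul_cancel₀ _ (hapos t ht 0 (by omega)).ne']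
    | succ j ih =>
      intro hj
      have i1 := ih (by omega)
      have k0 := h0 (j + 1) hj
      have k1 := h1 (j + 1) (by omega) hj
      rw [Nat.add_sub_cancel, i1] at k1
      have haj := hapos t ht j (by omega)
      have hbj := hbpos t ht (j + 1) (by omega) hj
      have e : b' (j + 1) t = c * b (j + 1) t := by
        apply mul_left_cancel₀ haj.ne'
        linarith
      rw [e] at k0
      apply mul_right_cancel₀ hbj.ne'
      linarith
  have hcb : ∀ j, j ≤ n → b' j t = c * b j t := by
    intro j hj
    have k0 := h0 j hj
    rw [hca j hj] at k0
    apply mul_left_cancel₀ (hapos t ht j hj).ne'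
    linarith
  have hM : bdMatrix n (fun j => a' j t) (fun j => b' j t) =
      c • bdMatrix n (fun j => a j t) (fun j => b j t) := by
    ext i j
    have hi : i.1 ≤ n := by omega
    simp only [bdMatrix, Matrix.of_apply, Matrix.smul_apply, smul_eq_mul, hca _ hi, hcb _ hi]
    split_ifs <;> ring
  have hder : ∀ i j, HasDerivAt
      (fun s => bdMatrix n (fun j => a j s) (fun j => b j s) i j)
      (c * bdMatrix n (fun j => a j t) (fun j => b j t) i j) t := by
    intro i j
    rw [← smul_eq_mul, ← Matrix.smul_apply, ← hM]
    simp only [bdMatrix, Matrix.of_apply]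
    split_ifs
    · exact (had _ t ht).add (hbd _ t ht)
    · exact had _ t ht
    · exact hbd _ t ht
    · exact hasDerivAt_const _ _
  have hl := lam_deriv n I hIopen (fun s => bdMatrix n (fun j => a j s) (fun j => b j s)) t c ht
    hder lam lam' hlam hlamd
  refine ⟨?_, ?_, ?_, hl⟩
  · rw [hM, Matrix.smul_mul, Matrix.mul_smul]
  · intro k
    obtain ⟨v, hv0, hv⟩ := (hlam t ht).2 k
    exact ⟨v, hv0, by rw [hM, Matrix.smul_mulVec, hv, smul_smul, hl]⟩
  · intro k
    exact bd_eig_pos n _ _ (hapos t ht) (hbpos t ht) (hb0 t ht) _ ((hlam t ht).2 k)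

/-- If `t ∈ A↑_0 ∩ A↑_1` then `A′(t)` and `A(t)` commute and
`0 < λ_0(A′(t)) = λ′_0(A,t) < ⋯ < λ_n(A′(t)) = λ′_n(A,t)`; if `t ∈ A↓_0 ∩ A↓_1` then
`A′(t)` and `A(t)` commute and `0 > λ_0(A′(t)) = λ′_0(A,t) > ⋯ > λ_n(A′(t)) = λ′_n(A,t)`. -/
theorem stmt17 (n : ℕ) (hn : 0 < n) (I : Set ℝ) (hIopen : IsOpen I)
    (hIconn : I.OrdConnected) (hIne : I.Nonempty)
    (a b a' b' : ℕ → ℝ → ℝ)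
    (hapos : ∀ t ∈ I, ∀ j, j ≤ n → 0 < a j t)
    (hbpos : ∀ t ∈ I, ∀ j, 1 ≤ j → j ≤ n → 0 < b j t)
    (hb0 : ∀ t ∈ I, 0 ≤ b 0 t)
    (had : ∀ j, ∀ t ∈ I, HasDerivAt (a j) (a' j t) t)
    (hbd : ∀ j, ∀ t ∈ I, HasDerivAt (b j) (b' j t) t)
    (lam lam' : Fin (n+1) → ℝ → ℝ)
    (hlam : ∀ t ∈ I, StrictMono (fun k : Fin (n+1) => lam k t) ∧
      ∀ k, IsEigR (bdMatrix n (fun j => a j t) (fun j => b j t)) (lam k t))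
    (hlamd : ∀ k, ∀ t ∈ I, HasDerivAt (lam k) (lam' k t) t) :
    (∀ t ∈ Aup0 n a b a' b' I ∩ Aup1 n a b a' b' I,
      bdMatrix n (fun j => a' j t) (fun j => b' j t) *
          bdMatrix n (fun j => a j t) (fun j => b j t) =
        bdMatrix n (fun j => a j t) (fun j => b j t) *
          bdMatrix n (fun j => a' j t) (fun j => b' j t) ∧
      0 < lam' 0 t ∧ StrictMono (fun k : Fin (n+1) => lam' k t) ∧
      ∀ k, IsEigR (bdMatrix n (fun j => a' j t) (fun j => b' j t)) (lam' k t)) ∧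
    (∀ t ∈ Adown0 n a b a' b' I ∩ Adown1 n a b a' b' I,
      bdMatrix n (fun j => a' j t) (fun j => b' j t) *
          bdMatrix n (fun j => a j t) (fun j => b j t) =
        bdMatrix n (fun j => a j t) (fun j => b j t) *
          bdMatrix n (fun j => a' j t) (fun j => b' j t) ∧
      lam' 0 t < 0 ∧ StrictAnti (fun k : Fin (n+1) => lam' k t) ∧
      ∀ k, IsEigR (bdMatrix n (fun j => a' j t) (fun j => b' j t)) (lam' k t)) := by
  constructor
  · rintro t ⟨⟨ht, h0⟩, _, _, h1⟩
    obtain ⟨r1, r2, r3, r4⟩ := bd_core n I hIopen a b a' b' hapos hbpos hb0 had hbd lam lam'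
      hlam hlamd t ht (fun j hj => (h0 j hj).2) (fun j hj hj' => (h1 j hj hj').2)
    have hc : 0 < a' 0 t / a 0 t := div_pos (h0 0 (by omega)).1 (hapos t ht 0 (by omega))
    refine ⟨r1, ?_, ?_, r2⟩
    · rw [r4]; exact mul_pos hc (r3 0)
    · intro i j hij
      simp only [r4]
      exact mul_lt_mul_of_pos_left ((hlam t ht).1 hij) hc
  · rintro t ⟨⟨ht, h0⟩, _, _, h1⟩
    obtain ⟨r1, r2, r3, r4⟩ := bd_core n I hIopen a b a' b' hapos hbpos hb0 had hbd lam lam'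
      hlam hlamd t ht (fun j hj => (h0 j hj).2) (fun j hj hj' => (h1 j hj hj').2)
    have hc : a' 0 t / a 0 t < 0 :=
      div_neg_of_neg_of_pos (h0 0 (by omega)).1 (hapos t ht 0 (by omega))
    refine ⟨r1, ?_, ?_, r2⟩
    · rw [r4]; exact mul_neg_of_neg_of_pos hc (r3 0)
    · intro i j hij
      simp only [r4]
      exact mul_lt_mul_of_neg_left ((hlam t ht).1 hij) hc
end

section
/- Let B(t) be the random walk matrix with parameters c_0(t),…,c_n(t), and set δ_j(t) = (1−c_{j+1}(t))·c_j(t) for j = 0,…,n−1. Define D↑_max = {t ∈ I : δ′_j(t) > 0 for all j = 0,…,n−1} and D↓_max analogously with <. Then the largest eigenvalue λ_max(B,t) of B(t) is a strictly increasing (respectively, strictly decreasing) function of t on each non-degenerate subinterval of D↑_max (respectively, of D↓_max). -/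
open Matrix Polynomial

/-- The `(n+1) × (n+1)` random walk matrix with data `c`: zero diagonal,
superdiagonal `c j`, subdiagonal `1 - c j`. -/
noncomputable def rwMatrix (n : ℕ) (c : ℕ → ℝ) : Matrix (Fin (n+1)) (Fin (n+1)) ℝ :=
  Matrix.of fun i j =>
    if (i : ℕ) = (j : ℕ) then 0
    else if (j : ℕ) = (i : ℕ) + 1 then c i.1
    else if (i : ℕ) = (j : ℕ) + 1 then 1 - c i.1
    else 0

/-- `D↑_max = {t ∈ I : δ′_j(t) > 0 for all j = 0,…,n−1}` where
`δ_j = (1 − c_{j+1}) c_j`, so `δ′_j = (1 − c_{j+1}) c′_j − c′_{j+1} c_j`. -/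
def DupMax (n : ℕ) (c c' : ℕ → ℝ → ℝ) (I : Set ℝ) : Set ℝ :=
  {t ∈ I | ∀ j, j < n → 0 < (1 - c (j+1) t) * c' j t - c' (j+1) t * c j t}

/-- `D↓_max` (with `<` in place of `>`). -/
def DdownMax (n : ℕ) (c c' : ℕ → ℝ → ℝ) (I : Set ℝ) : Set ℝ :=
  {t ∈ I | ∀ j, j < n → (1 - c (j+1) t) * c' j t - c' (j+1) t * c j t < 0}


/-- Rayleigh bound from a bound on all eigenvalues. -/
lemma rayleigh_le {N : Type*} [Fintype N] [DecidableEq N] (A : Matrix N N ℝ)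
    (hA : ∀ i j, A i j = A j i) (μ : ℝ) (h : ∀ e, IsEigR A e → e ≤ μ) (x : N → ℝ) :
    ∑ i, ∑ j, x i * A i j * x j ≤ μ * ∑ i, x i ^ 2 := by
  set M : Matrix N N ℝ := μ • (1 : Matrix N N ℝ) - A with hM
  have hH : M.IsHermitian := by
    ext i j
    simp only [hM, Matrix.conjTranspose_apply, Matrix.sub_apply, Matrix.smul_apply, star_trivial,
      Matrix.one_apply, hA i j, eq_comm]
  have hmul : ∀ v : N → ℝ, M *ᵥ v = μ • v - A *ᵥ v := by
    intro v
    rw [hM, Matrix.sub_mulVec, Matrix.smul_mulVec, Matrix.one_mulVec]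
  have hP : M.PosSemidef := by
    rw [hH.posSemidef_iff_eigenvalues_nonneg]
    intro k
    have hk := hH.mulVec_eigenvectorBasis k
    set v : N → ℝ := (hH.eigenvectorBasis k).ofLp with hv
    have hv0 : v ≠ 0 := by
      intro h0
      have := hH.eigenvectorBasis.orthonormal.ne_zero k
      apply this
      ext i
      exact congrFun h0 i
    have := h (μ - hH.eigenvalues k) ⟨v, hv0, by
      rw [hmul] at hk
      rw [sub_smul, ← hk]; abel⟩
    simp only [Pi.zero_apply]
    linarith
  have h1 := hP.dotProduct_mulVec_nonneg x
  rw [hmul, dotProduct_sub, dotProduct_smul] at h1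
  have h2 : star x ⬝ᵥ x = ∑ i, x i ^ 2 := by
    simp [dotProduct, sq]
  have h3 : star x ⬝ᵥ (A *ᵥ x) = ∑ i, ∑ j, x i * A i j * x j := by
    simp [dotProduct, Matrix.mulVec, Finset.mul_sum, mul_assoc]
  rw [h2, h3, smul_eq_mul] at h1
  linarith

lemma static_lt {N : Type*} [Fintype N] [DecidableEq N] (A A' : Matrix N N ℝ)
    (hA : ∀ i j, A i j = A j i) (hA' : ∀ i j, A' i j = A' j i)
    (h0 : ∀ i j, 0 ≤ A i j) (hle : ∀ i j, A i j ≤ A' i j)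
    (hlt : ∀ i j, 0 < A i j → A i j < A' i j) (hpos : ∃ i j, 0 < A i j)
    (l m : ℝ) (hl : IsGreatest {μ | IsEigR A μ} l) (hm : IsGreatest {μ | IsEigR A' μ} m) :
    l < m := by
  obtain ⟨i0, j0, hij⟩ := hpos
  have hlpos : 0 < l := by
    have h1 := rayleigh_le A hA l (fun e he => hl.2 he) (fun _ => 1)
    have h2 : 0 < ∑ i, ∑ j, (1:ℝ) * A i j * 1 := by
      apply Finset.sum_pos' (fun i _ => Finset.sum_nonneg fun j _ => by simpa using h0 i j)
      exact ⟨i0, Finset.mem_univ _, Finset.sum_pos' (fun j _ => by simpa using h0 i0 j)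
        ⟨j0, Finset.mem_univ _, by simpa using hij⟩⟩
    have h3 : (0:ℝ) ≤ ∑ i : N, (1:ℝ) ^ 2 := Finset.sum_nonneg fun _ _ => by norm_num
    by_contra hn
    nlinarith
  obtain ⟨w, hw0, hw⟩ := hl.1
  have hS : 0 < ∑ i, w i ^ 2 := by
    obtain ⟨k, hk⟩ := Function.ne_iff.1 hw0
    exact Finset.sum_pos' (fun i _ => sq_nonneg _) ⟨k, Finset.mem_univ _, by
      have : w k ≠ 0 := hk
      positivity⟩
  have hE : ∑ i, ∑ j, w i * A i j * w j = l * ∑ i, w i ^ 2 := by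
    rw [Finset.mul_sum]
    refine Finset.sum_congr rfl fun i _ => ?_
    have := congrFun hw i
    simp only [Matrix.mulVec, dotProduct, Pi.smul_apply, smul_eq_mul] at this
    simp only [mul_assoc]
    rw [← Finset.mul_sum, this]; ring
  have hab : ∑ i, ∑ j, w i * A i j * w j ≤ ∑ i, ∑ j, |w i| * A i j * |w j| := by
    refine Finset.sum_le_sum fun i _ => Finset.sum_le_sum fun j _ => ?_
    calc _ ≤ |w i * A i j * w j| := le_abs_self _
      _ = _ := by rw [abs_mul, abs_mul, abs_of_nonneg (h0 i j)]
  have hle2 : ∀ i j, |w i| * A i j * |w j| ≤ |w i| * A' i j * |w j| := fun i j => by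
    have := hle i j
    gcongr
  have hst : ∑ i, ∑ j, |w i| * A i j * |w j| < ∑ i, ∑ j, |w i| * A' i j * |w j| := by
    have hp : 0 < ∑ i, ∑ j, |w i| * A i j * |w j| := by
      have := mul_pos hlpos hS
      linarith
    obtain ⟨i, _, hi⟩ := Finset.exists_lt_of_sum_lt (s := Finset.univ) (f := fun _ : N => (0:ℝ))
      (by simpa using hp)
    obtain ⟨j, _, hj⟩ := Finset.exists_lt_of_sum_lt (s := Finset.univ) (f := fun _ : N => (0:ℝ))
      (g := fun j => |w i| * A i j * |w j|) (by simpa using hi)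
    refine Finset.sum_lt_sum (fun i _ => Finset.sum_le_sum fun j _ => hle2 i j)
      ⟨i, Finset.mem_univ _, Finset.sum_lt_sum (fun j _ => hle2 i j) ⟨j, Finset.mem_univ _, ?_⟩⟩
    have hwi : 0 < |w i| := by
      rcases (abs_nonneg (w i)).eq_or_lt with h | h
      · rw [← h] at hj; simp at hj
      · exact h
    have hwj : 0 < |w j| := by
      rcases (abs_nonneg (w j)).eq_or_lt with h | h
      · rw [← h] at hj; simp at hj
      · exact h
    have hAij : 0 < A i j := by
      rcases (h0 i j).eq_or_lt with h | h
      · rw [← h] at hj; simp at hj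
      · exact h
    have := hlt i j hAij
    gcongr
  have hfin := rayleigh_le A' hA' m (fun e he => hm.2 he) (fun i => |w i|)
  simp only [sq_abs] at hfin
  have : l * ∑ i, w i ^ 2 < m * ∑ i, w i ^ 2 := by linarith
  exact lt_of_mul_lt_mul_right this hS.le

/-- Symmetric tridiagonal matrix. -/
noncomputable def symT (n : ℕ) (s : ℕ → ℝ) : Matrix (Fin (n+1)) (Fin (n+1)) ℝ :=
  Matrix.of fun i j =>
    if (j : ℕ) = (i : ℕ) + 1 then s i.1
    else if (i : ℕ) = (j : ℕ) + 1 then s j.1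
    else 0

lemma symT_symm (n : ℕ) (s : ℕ → ℝ) (i j) : symT n s i j = symT n s j i := by
  simp only [symT, Matrix.of_apply]
  split_ifs <;> first | rfl | omega

lemma eig_iff (n : ℕ) (c : ℕ → ℝ) (hp : ∀ j, j ≤ n → 0 < c j)
    (hl : ∀ j, 1 ≤ j → j ≤ n → c j < 1) (μ : ℝ) :
    IsEigR (rwMatrix n c) μ ↔ IsEigR (symT n fun j => √((1 - c (j+1)) * c j)) μ := by
  set g : ℕ → ℝ := fun k => ∏ j ∈ Finset.range k, (√(1 - c (j+1)) / √(c j)) with hg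
  have hgpos : ∀ k, k ≤ n → 0 < g k := by
    intro k hk
    refine Finset.prod_pos fun j hj => ?_
    have hj := Finset.mem_range.1 hj
    have h1 := hp j (by omega)
    have h2 := hl (j+1) (by omega) (by omega)
    have h3 : 0 < 1 - c (j+1) := by linarith
    positivity
  have hgs : ∀ k, g (k+1) = g k * (√(1 - c (k+1)) / √(c k)) := fun k => Finset.prod_range_succ _ _
  have key : ∀ i j : Fin (n+1), rwMatrix n c i j * g j
      = g i * symT n (fun j => √((1 - c (j+1)) * c j)) i j := by
    intro i j
    obtain ⟨i, hi⟩ := i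
    obtain ⟨j, hj⟩ := j
    simp only [rwMatrix, symT, Matrix.of_apply]
    by_cases h1 : i = j
    · subst h1; simp
    by_cases h2 : j = i + 1
    · subst h2
      have h3 := hp i (by omega)
      have h5 : 0 < √(c i) := Real.sqrt_pos.2 h3
      have h4 : 0 < 1 - c (i+1) := by linarith [hl (i+1) (by omega) (by omega)]
      simp only [h1, if_false, if_true, hgs, Real.sqrt_mul h4.le]
      nth_rewrite 1 [← Real.mul_self_sqrt h3.le]
      field_simp
    by_cases h3 : i = j + 1
    · subst h3
      have h3 := hp j (by omega)
      have h5 : 0 < √(c j) := Real.sqrt_pos.2 h3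
      have h4 : 0 < 1 - c (j+1) := by linarith [hl (j+1) (by omega) (by omega)]
      simp only [h1, h2, if_false, if_true, hgs, Real.sqrt_mul h4.le]
      nth_rewrite 1 [← Real.mul_self_sqrt h4.le]
      field_simp
    simp [h1, h2, h3]
  have hmain : ∀ w : Fin (n+1) → ℝ,
      rwMatrix n c *ᵥ (fun j => g j * w j)
        = fun i : Fin (n+1) => g i * (symT n (fun j => √((1 - c (j+1)) * c j)) *ᵥ w) i := by
    intro w
    ext i
    simp only [Matrix.mulVec, dotProduct, Finset.mul_sum]
    refine Finset.sum_congr rfl fun j _ => ?_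
    rw [← mul_assoc, key, mul_assoc]
  have hgne : ∀ i : Fin (n+1), g i ≠ 0 := fun i => (hgpos i (by omega)).ne'
  constructor
  · rintro ⟨v, hv0, hv⟩
    have hvw : (fun j : Fin (n+1) => g j * (v j / g j)) = v := by
      ext j; have := hgne j; field_simp
    refine ⟨fun j => v j / g j, ?_, ?_⟩
    · intro h
      apply hv0
      rw [← hvw]
      ext j
      have := congrFun h j
      simp only [Pi.zero_apply] at this
      simp [this]
    · have h := hmain (fun j => v j / g j)
      rw [hvw, hv] at h
      ext i
      have h' := congrFun h i
      simp only [Pi.smul_apply, smul_eq_mul] at h' ⊢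
      have := hgne i
      apply mul_left_cancel₀ this
      rw [← h']
      field_simp
  · rintro ⟨w, hw0, hw⟩
    refine ⟨fun j => g j * w j, ?_, ?_⟩
    · intro h
      apply hw0
      ext j
      have := congrFun h j
      simpa [hgne j] using this
    · rw [hmain, hw]
      ext i
      simp only [Pi.smul_apply, smul_eq_mul]
      ring

lemma rw_lt (n : ℕ) (hn : 0 < n) (c d : ℕ → ℝ) (hp : ∀ j, j ≤ n → 0 < c j)
    (hl : ∀ j, 1 ≤ j → j ≤ n → c j < 1) (hp' : ∀ j, j ≤ n → 0 < d j)
    (hl' : ∀ j, 1 ≤ j → j ≤ n → d j < 1)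
    (hlt : ∀ j, j < n → (1 - c (j+1)) * c j < (1 - d (j+1)) * d j) (l m : ℝ)
    (h1 : IsGreatest {μ : ℝ | IsEigR (rwMatrix n c) μ} l)
    (h2 : IsGreatest {μ : ℝ | IsEigR (rwMatrix n d) μ} m) : l < m := by
  simp only [eig_iff n c hp hl] at h1
  simp only [eig_iff n d hp' hl'] at h2
  have hs : ∀ j, j < n → √((1 - c (j+1)) * c j) < √((1 - d (j+1)) * d j) := fun j hj => by
    have a := hp j hj.le
    have b := hl (j+1) (by omega) (by omega)
    exact Real.sqrt_lt_sqrt (mul_nonneg (by linarith) a.le) (hlt j hj)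
  refine static_lt _ _ (symT_symm _ _) (symT_symm _ _) ?_ ?_ ?_ ?_ l m h1 h2
  · intro i j
    simp only [symT, Matrix.of_apply]
    split_ifs <;> positivity
  · intro i j
    simp only [symT, Matrix.of_apply]
    split_ifs
    · exact (hs _ (by omega)).le
    · exact (hs _ (by omega)).le
    · exact le_rfl
  · intro i j
    simp only [symT, Matrix.of_apply]
    split_ifs
    · exact fun _ => hs _ (by omega)
    · exact fun _ => hs _ (by omega)
    · exact fun h => absurd h (lt_irrefl _)
  · refine ⟨⟨0, by omega⟩, ⟨1, by omega⟩, ?_⟩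
    simp only [symT, Matrix.of_apply, zero_add, if_true]
    have a := hp 0 hn.le
    have b := hl 1 le_rfl hn
    exact Real.sqrt_pos.2 (mul_pos (by linarith) a)

/-- The largest eigenvalue `λ_max(B,t)` of the random walk matrix `B(t)` is strictly
increasing (resp. strictly decreasing) on each subinterval of `D↑_max` (resp. `D↓_max`). -/
theorem stmt18 (n : ℕ) (hn : 0 < n) (I : Set ℝ) (hIopen : IsOpen I)
    (hIconn : I.OrdConnected) (hIne : I.Nonempty)
    (c c' : ℕ → ℝ → ℝ)
    (hc_pos : ∀ t ∈ I, ∀ j, j ≤ n → 0 < c j t ∧ c j t ≤ 1)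
    (hc_lt : ∀ t ∈ I, ∀ j, 1 ≤ j → j ≤ n → c j t < 1)
    (hcd : ∀ j, ∀ t ∈ I, HasDerivAt (c j) (c' j t) t)
    (hcc : ∀ j, ContinuousOn (c' j) I)
    (lmax : ℝ → ℝ)
    (hlmax : ∀ t ∈ I,
      IsGreatest {μ : ℝ | IsEigR (rwMatrix n (fun j => c j t)) μ} (lmax t)) :
    (∀ J : Set ℝ, J ⊆ DupMax n c c' I → J.OrdConnected → StrictMonoOn lmax J) ∧
    (∀ J : Set ℝ, J ⊆ DdownMax n c c' I → J.OrdConnected → StrictAntiOn lmax J) := by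
  have hder : ∀ j, ∀ t ∈ I, HasDerivAt (fun t => (1 - c (j+1) t) * c j t)
      ((1 - c (j+1) t) * c' j t - c' (j+1) t * c j t) t := by
    intro j t ht
    have h := ((hcd (j+1) t ht).const_sub 1).mul (hcd j t ht)
    exact h.congr_deriv (by ring)
  constructor
  · intro J hJ hJc s hs t ht hst
    have hsub : Set.Icc s t ⊆ J := hJc.out hs ht
    refine rw_lt n hn _ _ (fun j hj => (hc_pos s (hJ hs).1 j hj).1) (hc_lt s (hJ hs).1)
      (fun j hj => (hc_pos t (hJ ht).1 j hj).1) (hc_lt t (hJ ht).1) ?_ _ _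
      (hlmax s (hJ hs).1) (hlmax t (hJ ht).1)
    intro j hj
    have hmono : StrictMonoOn (fun t => (1 - c (j+1) t) * c j t) (Set.Icc s t) := by
      refine strictMonoOn_of_deriv_pos (convex_Icc s t)
        (fun x hx => (hder j x (hJ (hsub hx)).1).continuousAt.continuousWithinAt) fun x hx => ?_
      have hx' := hJ (hsub (interior_subset hx))
      rw [(hder j x hx'.1).deriv]
      exact hx'.2 j hj
    exact hmono (Set.left_mem_Icc.2 hst.le) (Set.right_mem_Icc.2 hst.le) hst
  · intro J hJ hJc s hs t ht hst
    have hsub : Set.Icc s t ⊆ J := hJc.out hs ht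
    refine rw_lt n hn _ _ (fun j hj => (hc_pos t (hJ ht).1 j hj).1) (hc_lt t (hJ ht).1)
      (fun j hj => (hc_pos s (hJ hs).1 j hj).1) (hc_lt s (hJ hs).1) ?_ _ _
      (hlmax t (hJ ht).1) (hlmax s (hJ hs).1)
    intro j hj
    have hanti : StrictAntiOn (fun t => (1 - c (j+1) t) * c j t) (Set.Icc s t) := by
      refine strictAntiOn_of_deriv_neg (convex_Icc s t)
        (fun x hx => (hder j x (hJ (hsub hx)).1).continuousAt.continuousWithinAt) fun x hx => ?_
      have hx' := hJ (hsub (interior_subset hx))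
      rw [(hder j x hx'.1).deriv]
      exact hx'.2 j hj
    exact hanti (Set.left_mem_Icc.2 hst.le) (Set.right_mem_Icc.2 hst.le) hst
end
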